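/- There exists a constant c > 0 such that for all n, M ≥ 1, every type promise T ⊆ [M]^n, and every partial function f : T → Bool, the bounded-error randomized query complexity satisfies R(f) ≥ c · C(f)^{1/2}. -/

import Mathlib

open scoped Classical

namespace QCPaper

/-- A partial assignment `c` is consistent with the input `x` if it agrees with `x`
wherever it is defined. -/
def Consistent {n M : ℕ} (c : Fin n → Option (Fin M)) (x : Fin n → Fin M) : Prop :=
  ∀ i : Fin n, ∀ a : Fin M, c i = some a → x i = a

/-- The size of a partial assignment: the number of indices where it is defined. -/
def paSize {n M : ℕ} (c : Fin n → Option (Fin M)) : ℕ :=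
  (Finset.univ.filter fun i => c i ≠ none).card

/-- `c` is a certificate for the partial function `f` with promise `X`:
all inputs in `X` consistent with `c` get the same value under `f`. -/
def IsCertificate {n M : ℕ} (X : Set (Fin n → Fin M)) (f : (Fin n → Fin M) → Bool)
    (c : Fin n → Option (Fin M)) : Prop :=
  ∀ x ∈ X, ∀ y ∈ X, Consistent c x → Consistent c y → f x = f y

/-- The certificate complexity of `f` at the input `x`:
the least size of a certificate for `f` consistent with `x`. -/
noncomputable def Cx {n M : ℕ} (X : Set (Fin n → Fin M)) (f : (Fin n → Fin M) → Bool)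
    (x : Fin n → Fin M) : ℕ :=
  sInf {k | ∃ c : Fin n → Option (Fin M),
    IsCertificate X f c ∧ Consistent c x ∧ paSize c = k}

/-- The certificate complexity `C(f)`: the maximum of `Cx` over inputs in the promise. -/
noncomputable def certC {n M : ℕ} (X : Set (Fin n → Fin M))
    (f : (Fin n → Fin M) → Bool) : ℕ :=
  sSup {k | ∃ x ∈ X, Cx X f x = k}

/-- `b` is a sensitive block of `x` for `f` (with promise `X`). -/
def SensBlock {n M : ℕ} (X : Set (Fin n → Fin M)) (f : (Fin n → Fin M) → Bool)
    (x : Fin n → Fin M) (b : Finset (Fin n)) : Prop :=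
  ∃ y ∈ X, f y ≠ f x ∧ ∀ i : Fin n, y i ≠ x i → i ∈ b

/-- The block sensitivity of `f` at `x`: the largest number of pairwise disjoint
sensitive blocks of `x`. -/
noncomputable def bsx {n M : ℕ} (X : Set (Fin n → Fin M)) (f : (Fin n → Fin M) → Bool)
    (x : Fin n → Fin M) : ℕ :=
  sSup {m | ∃ b : Fin m → Finset (Fin n),
    (∀ j, SensBlock X f x (b j)) ∧ ∀ j j', j ≠ j' → Disjoint (b j) (b j')}

/-- The block sensitivity `bs(f)`. -/
noncomputable def bs {n M : ℕ} (X : Set (Fin n → Fin M))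
    (f : (Fin n → Fin M) → Bool) : ℕ :=
  sSup {m | ∃ x ∈ X, bsx X f x = m}

/-- The sensitivity of `f` at `x`: the largest number of pairwise disjoint
sensitive blocks of `x`, each of size 2. -/
noncomputable def sx {n M : ℕ} (X : Set (Fin n → Fin M)) (f : (Fin n → Fin M) → Bool)
    (x : Fin n → Fin M) : ℕ :=
  sSup {m | ∃ b : Fin m → Finset (Fin n),
    (∀ j, SensBlock X f x (b j) ∧ (b j).card = 2) ∧ ∀ j j', j ≠ j' → Disjoint (b j) (b j')}

/-- The sensitivity `s(f)`. -/
noncomputable def sens {n M : ℕ} (X : Set (Fin n → Fin M))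
    (f : (Fin n → Fin M) → Bool) : ℕ :=
  sSup {m | ∃ x ∈ X, sx X f x = m}

/-- The type of an input: the multiset of its entries. -/
def typeOf {n M : ℕ} (x : Fin n → Fin M) : Multiset (Fin M) :=
  Finset.univ.val.map x

/-- The multiplicity of the alphabet element `a` in the input `x`. -/
def mult {n M : ℕ} (x : Fin n → Fin M) (a : Fin M) : ℕ :=
  (Finset.univ.filter fun i => x i = a).card

/-- A type promise: the (nonempty) set of all strings with one fixed type. -/
def IsTypePromise {n M : ℕ} (T : Set (Fin n → Fin M)) : Prop :=
  ∃ x₀ : Fin n → Fin M, T = {x | typeOf x = typeOf x₀}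

/-- Decision trees over `[M]^n`: either a leaf with a Boolean answer, or a query
to an index together with a subtree for each possible answer. -/
inductive DTree (n M : ℕ) : Type
  | leaf : Bool → DTree n M
  | node : Fin n → (Fin M → DTree n M) → DTree n M

/-- Evaluation of a decision tree on an input. -/
def DTree.eval {n M : ℕ} : DTree n M → (Fin n → Fin M) → Bool
  | .leaf b, _ => b
  | .node i ts, x => (ts (x i)).eval x

/-- The cost of a decision tree on an input: the number of queries made. -/
def DTree.cost {n M : ℕ} : DTree n M → (Fin n → Fin M) → ℕ
  | .leaf _, _ => 0
  | .node i ts, x => (ts (x i)).cost x + 1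

/-- The depth of a decision tree: its maximum cost over all inputs. -/
def DTree.depth {n M : ℕ} : DTree n M → ℕ
  | .leaf _ => 0
  | .node _ ts => (Finset.univ.sup fun a => (ts a).depth) + 1

/-- The tree `t` computes `f` on the promise `X`. -/
def Computes {n M : ℕ} (X : Set (Fin n → Fin M)) (f : (Fin n → Fin M) → Bool)
    (t : DTree n M) : Prop :=
  ∀ x ∈ X, t.eval x = f x

/-- The deterministic query complexity `D(f)`:
the least depth of a decision tree computing `f`. -/
noncomputable def detD {n M : ℕ} (X : Set (Fin n → Fin M))
    (f : (Fin n → Fin M) → Bool) : ℕ :=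
  sInf {d | ∃ t : DTree n M, Computes X f t ∧ t.depth = d}

/-- A finitely supported probability distribution over decision trees,
given as a finite list of trees with probabilities. -/
structure RandAlg (n M : ℕ) where
  N : ℕ
  tree : Fin N → DTree n M
  prob : Fin N → ℝ
  nonneg : ∀ j, 0 ≤ prob j
  sum_one : ∑ j, prob j = 1

/-- The expected cost of a randomized algorithm on the input `x`. -/
noncomputable def expCost {n M : ℕ} (A : RandAlg n M) (x : Fin n → Fin M) : ℝ :=
  ∑ j, A.prob j * ((A.tree j).cost x : ℝ)

/-- `A` is a zero-error randomized algorithm for `f`: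
every tree in its support computes `f`. -/
def ZeroError {n M : ℕ} (X : Set (Fin n → Fin M)) (f : (Fin n → Fin M) → Bool)
    (A : RandAlg n M) : Prop :=
  ∀ j, A.prob j ≠ 0 → Computes X f (A.tree j)

/-- The cost of a randomized algorithm: the maximum over inputs in the promise of
the expected cost. -/
noncomputable def algCost {n M : ℕ} (X : Set (Fin n → Fin M)) (A : RandAlg n M) : ℝ :=
  sSup {r | ∃ x ∈ X, r = expCost A x}

/-- The zero-error randomized query complexity `R₀(f)`:
the infimum cost of a zero-error randomized algorithm for `f`. -/
noncomputable def R0 {n M : ℕ} (X : Set (Fin n → Fin M))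
    (f : (Fin n → Fin M) → Bool) : ℝ :=
  sInf {r | ∃ A : RandAlg n M, ZeroError X f A ∧ algCost X A = r}

/-- `A` is a bounded-error randomized algorithm for `f`: on every input in the promise,
it returns the correct answer with probability at least 2/3. -/
def BoundedError {n M : ℕ} (X : Set (Fin n → Fin M)) (f : (Fin n → Fin M) → Bool)
    (A : RandAlg n M) : Prop :=
  ∀ x ∈ X, (2/3 : ℝ) ≤ ∑ j ∈ Finset.univ.filter fun j => (A.tree j).eval x = f x, A.prob j

/-- The depth of a randomized algorithm: the maximum depth of a tree in its support. -/
noncomputable def suppDepth {n M : ℕ} (A : RandAlg n M) : ℕ :=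
  (Finset.univ.filter fun j => A.prob j ≠ 0).sup fun j => (A.tree j).depth

/-- The bounded-error randomized query complexity `R(f)`:
the least depth of a bounded-error randomized algorithm for `f`. -/
noncomputable def randR {n M : ℕ} (X : Set (Fin n → Fin M))
    (f : (Fin n → Fin M) → Bool) : ℕ :=
  sInf {d | ∃ A : RandAlg n M, BoundedError X f A ∧ suppDepth A = d}

/-- A set of inputs is symmetric if it is invariant under permuting coordinates. -/
def SymmetricSet {n M : ℕ} (X : Set (Fin n → Fin M)) : Prop :=
  ∀ x ∈ X, ∀ σ : Equiv.Perm (Fin n), (x ∘ σ) ∈ X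

/-- A function is symmetric if its value depends only on the type of the input. -/
def SymmetricFun {n M : ℕ} (X : Set (Fin n → Fin M))
    (f : (Fin n → Fin M) → Bool) : Prop :=
  ∀ x ∈ X, ∀ y ∈ X, typeOf x = typeOf y → f x = f y

/-- The measure `d(f)` for a non-constant symmetric function: the least distance between
the types of two inputs in the promise with different values under `f`. -/
noncomputable def dgap {n M : ℕ} (X : Set (Fin n → Fin M))
    (f : (Fin n → Fin M) → Bool) : ℕ :=
  sInf {d | ∃ x ∈ X, ∃ y ∈ X, f x ≠ f y ∧
    (Finset.univ.sup fun a => Nat.dist (mult x a) (mult y a)) = d}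

theorem exists_perm_of_map_univ_eq {α β : Type*} [Fintype α] {f g : α → β}
    (h : Finset.univ.val.map f = Finset.univ.val.map g) :
    ∃ e : Equiv.Perm α, ∀ i, g (e i) = f i := by
  have hc : ∀ b, Nonempty ({a // f a = b} ≃ {a // g a = b}) := by
    intro b
    have hb := congrArg (Multiset.count b) h
    rw [Multiset.count_map, Multiset.count_map] at hb
    refine Fintype.card_eq.mp ?_
    rw [Fintype.card_subtype, Fintype.card_subtype]
    simpa [Finset.card_def, Finset.filter_val, eq_comm] using hb
  exact ⟨Equiv.ofFiberEquiv fun b => (hc b).some, fun i => Equiv.ofFiberEquiv_map _ i⟩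

theorem exists_perm_of_map_eq {α β : Type*} {s : Finset α} {f g : α → β}
    (h : s.val.map f = s.val.map g) : ∃ e : Equiv.Perm s, ∀ i, g (e i) = f i := by
  refine exists_perm_of_map_univ_eq (f := fun i : s => f i) (g := fun i : s => g i) ?_
  exact (Multiset.attach_map_val' s.val f).trans (h.trans (Multiset.attach_map_val' s.val g).symm)

theorem typeOf_comp_perm {n M : ℕ} (x : Fin n → Fin M) (σ : Equiv.Perm (Fin n)) :
    typeOf (x ∘ σ) = typeOf x := by
  rw [typeOf, ← Multiset.map_map, Multiset.map_univ_val_equiv, typeOf]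

/-- Two inputs of the same type are rearrangements of each other on the set where they differ. -/
theorem exists_perm_diff {n M : ℕ} {x y : Fin n → Fin M} (h : typeOf x = typeOf y)
    {b : Finset (Fin n)} (hb : ∀ i, y i ≠ x i → i ∈ b) :
    ∃ e : Equiv.Perm b, ∀ i, y (e i) = x i := by
  apply exists_perm_of_map_eq
  have hsplit : ∀ z : Fin n → Fin M, typeOf z = b.val.map z + bᶜ.val.map z := by
    intro z
    rw [← Multiset.map_add, ← Finset.disjUnion_val b bᶜ disjoint_compl_right,
      Finset.disjUnion_eq_union, Finset.union_compl, typeOf]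
  have hc : bᶜ.val.map x = bᶜ.val.map y := by
    refine Multiset.map_congr rfl fun i hi => ?_
    by_contra hne
    exact Finset.mem_compl.mp hi (hb i (Ne.symm hne))
  rw [hsplit, hsplit, hc] at h
  exact add_right_cancel h

/-- The indices queried by a decision tree on an input. -/
def DTree.queried {n M : ℕ} : DTree n M → (Fin n → Fin M) → Finset (Fin n)
  | .leaf _, _ => ∅
  | .node i ts, x => insert i ((ts (x i)).queried x)

theorem DTree.card_queried_le {n M : ℕ} (t : DTree n M) (x : Fin n → Fin M) :
    (t.queried x).card ≤ t.depth := by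
  induction t with
  | leaf => simp [queried]
  | node i ts ih =>
    refine (Finset.card_insert_le _ _).trans (Nat.succ_le_succ ((ih (x i)).trans ?_))
    exact Finset.le_sup (f := fun a => (ts a).depth) (Finset.mem_univ _)

theorem DTree.eval_eq_of_agree {n M : ℕ} (t : DTree n M) {x y : Fin n → Fin M}
    (h : ∀ i ∈ t.queried x, y i = x i) : t.eval y = t.eval x := by
  induction t with
  | leaf => rfl
  | node i ts ih =>
    rw [queried] at h
    rw [eval, eval, h i (Finset.mem_insert_self _ _)]
    exact ih _ fun j hj => h j (Finset.mem_insert_of_mem hj)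

theorem DTree.exists_eval_eq {n M : ℕ} (x₀ : Fin n → Fin M) (s : Finset (Fin n)) :
    ∀ g : (Fin n → Fin M) → Bool, (∀ x y, (∀ i ∈ s, x i = y i) → g x = g y) →
      ∃ t : DTree n M, ∀ x, t.eval x = g x := by
  induction s using Finset.induction_on with
  | empty => exact fun g hg => ⟨.leaf (g x₀), fun x => hg _ _ (by simp)⟩
  | insert i s _ ih =>
    intro g hg
    have hsub : ∀ a, ∃ t : DTree n M, ∀ x, t.eval x = g (Function.update x i a) := by
      intro a
      refine ih (fun x => g (Function.update x i a)) fun x y hxy => hg _ _ fun j hj => ?_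
      by_cases hji : j = i
      · subst hji; simp
      · simpa [hji] using hxy j ((Finset.mem_insert.mp hj).resolve_left hji)
    choose ts hts using hsub
    exact ⟨.node i ts, fun x => by simp [eval, hts]⟩

theorem exists_boundedError {n M : ℕ} (x₀ : Fin n → Fin M) (X : Set (Fin n → Fin M))
    (f : (Fin n → Fin M) → Bool) : ∃ A : RandAlg n M, BoundedError X f A := by
  obtain ⟨t, ht⟩ := DTree.exists_eval_eq x₀ Finset.univ f
    fun x y h => congrArg f (funext fun i => h i (Finset.mem_univ i))
  refine ⟨⟨1, fun _ => t, fun _ => 1, fun _ => zero_le_one, by simp⟩, fun x _ => ?_⟩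
  simp only [ht, Finset.filter_true, Finset.univ_unique, Finset.sum_singleton]
  norm_num

/-- On an input, a bounded-error algorithm queries each sensitive block with probability at
least `1/3`. -/
theorem one_third_le_prob_query {n M : ℕ} {X : Set (Fin n → Fin M)}
    {f : (Fin n → Fin M) → Bool} {A : RandAlg n M} (hA : BoundedError X f A)
    {x : Fin n → Fin M} (hx : x ∈ X) {b : Finset (Fin n)} (hb : SensBlock X f x b) :
    (1 / 3 : ℝ) ≤ ∑ j, A.prob j * (((A.tree j).queried x ∩ b).card : ℝ) := by
  obtain ⟨y, hy, hne, hd⟩ := hb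
  have h1 := hA x hx
  have h2 := hA y hy
  rw [Finset.sum_filter] at h1 h2
  have key : ∀ j, ((if (A.tree j).eval x = f x then A.prob j else 0) +
      (if (A.tree j).eval y = f y then A.prob j else 0)) ≤
      A.prob j + A.prob j * (((A.tree j).queried x ∩ b).card : ℝ) := by
    intro j
    have hp := A.nonneg j
    by_cases hq : (A.tree j).queried x ∩ b = ∅
    · have he : (A.tree j).eval y = (A.tree j).eval x := by
        refine DTree.eval_eq_of_agree _ fun i hi => ?_
        by_contra hi'
        have : i ∈ (A.tree j).queried x ∩ b := Finset.mem_inter.mpr ⟨hi, hd i hi'⟩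
        simp [hq] at this
      rw [hq, he]
      by_cases hex : (A.tree j).eval x = f x
      · simp [hex, hne.symm]
      · rw [if_neg hex]
        split_ifs <;> simp [hp]
    · have hc : (1 : ℝ) ≤ (((A.tree j).queried x ∩ b).card : ℝ) := by
        exact_mod_cast Finset.card_pos.mpr (Finset.nonempty_iff_ne_empty.mpr hq)
      have := mul_le_mul_of_nonneg_left hc hp
      split_ifs <;> linarith
  have hsum := Finset.sum_le_sum fun j (_ : j ∈ Finset.univ) => key j
  rw [Finset.sum_add_distrib, Finset.sum_add_distrib, A.sum_one] at hsum
  linarith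

/-- If each index lies in at most `k` of the sensitive blocks of a family, then the family has at
most `3 * k * d` blocks, where `d` is the depth of a bounded-error algorithm. -/
theorem card_le_of_sensBlocks {n M : ℕ} {X : Set (Fin n → Fin M)}
    {f : (Fin n → Fin M) → Bool} {A : RandAlg n M} (hA : BoundedError X f A)
    {x : Fin n → Fin M} (hx : x ∈ X) {ι : Type*} (s : Finset ι) (b : ι → Finset (Fin n))
    (hb : ∀ i ∈ s, SensBlock X f x (b i)) {k : ℕ}
    (hk : ∀ q, (s.filter fun i => q ∈ b i).card ≤ k) :
    s.card ≤ 3 * k * suppDepth A := by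
  have hcount : ∀ Q : Finset (Fin n), ∑ i ∈ s, (Q ∩ b i).card ≤ k * Q.card := by
    intro Q
    calc ∑ i ∈ s, (Q ∩ b i).card
        = ∑ q ∈ Q, (s.filter fun i => q ∈ b i).card := by
          simp only [← Finset.filter_mem_eq_inter, Finset.card_filter]
          exact Finset.sum_comm
      _ ≤ ∑ _q ∈ Q, k := Finset.sum_le_sum fun q _ => hk q
      _ = k * Q.card := by rw [Finset.sum_const, smul_eq_mul, mul_comm]
  have hle : (s.card : ℝ) * (1 / 3) ≤ k * suppDepth A := by
    calc (s.card : ℝ) * (1 / 3)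
        = ∑ _i ∈ s, (1 / 3 : ℝ) := by simp
      _ ≤ ∑ i ∈ s, ∑ j, A.prob j * (((A.tree j).queried x ∩ b i).card : ℝ) :=
          Finset.sum_le_sum fun i hi => one_third_le_prob_query hA hx (hb i hi)
      _ = ∑ j, A.prob j * ((∑ i ∈ s, ((A.tree j).queried x ∩ b i).card : ℕ) : ℝ) := by
          rw [Finset.sum_comm]
          simp [Finset.mul_sum]
      _ ≤ ∑ j, A.prob j * (k * suppDepth A : ℝ) := by
          refine Finset.sum_le_sum fun j _ => ?_
          by_cases hj : A.prob j = 0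
          · simp [hj]
          · refine mul_le_mul_of_nonneg_left ?_ (A.nonneg j)
            have hdepth : (A.tree j).depth ≤ suppDepth A :=
              Finset.le_sup (f := fun j => (A.tree j).depth)
                (Finset.mem_filter.mpr ⟨Finset.mem_univ j, hj⟩)
            exact_mod_cast (hcount _).trans
              (Nat.mul_le_mul_left k (((A.tree j).card_queried_le x).trans hdepth))
      _ = k * suppDepth A := by rw [← Finset.sum_mul, A.sum_one, one_mul]
  have : (s.card : ℝ) ≤ ((3 * k * suppDepth A : ℕ) : ℝ) := by
    push_cast
    linarith
  exact_mod_cast this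

/-- On a type promise, minimal sensitive blocks have size linear in the depth of a bounded-error
algorithm. -/
theorem card_minimal_sensBlock_le {n M : ℕ} {T : Set (Fin n → Fin M)} (hT : IsTypePromise T)
    {f : (Fin n → Fin M) → Bool} {A : RandAlg n M} (hA : BoundedError T f A)
    {x : Fin n → Fin M} (hx : x ∈ T) {b : Finset (Fin n)}
    (hb : Minimal (SensBlock T f x) b) : b.card ≤ 6 * suppDepth A := by
  obtain ⟨x₀, rfl⟩ := hT
  obtain ⟨y, hy, hne, hd⟩ := hb.prop
  have hbd : ∀ i ∈ b, y i ≠ x i := by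
    intro i hi
    have := hb.le_of_le (y := Finset.univ.filter fun i => y i ≠ x i)
      ⟨y, hy, hne, fun i hi => by simpa using hi⟩ (fun i hi => hd i (by simpa using hi))
    simpa using this hi
  obtain ⟨e, he⟩ := exists_perm_diff (hx.trans hy.symm) hd
  have hcard := card_le_of_sensBlocks (k := 2) hA hy (Finset.univ : Finset b)
    (fun i => {(i : Fin n), (e i : Fin n)}) (fun i _ => ?_) (fun q => ?_)
  · simpa using hcard
  · refine ⟨y ∘ Equiv.swap (i : Fin n) (e i), (typeOf_comp_perm _ _).trans hy, ?_, ?_⟩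
    · intro hfz
      have hsens : SensBlock {x | typeOf x = typeOf x₀} f x (b.erase i) := by
        refine ⟨y ∘ Equiv.swap (i : Fin n) (e i), (typeOf_comp_perm _ _).trans hy,
          by rwa [hfz], fun j hj => ?_⟩
        have hji : j ≠ i := by
          rintro rfl
          exact hj (by simp [he])
        refine Finset.mem_erase.mpr ⟨hji, ?_⟩
        by_cases hje : j = e i
        · exact hje ▸ (e i).2
        · exact hd j (by simpa [Equiv.swap_apply_of_ne_of_ne hji hje] using hj)
      have := hb.le_of_le hsens (Finset.erase_subset _ _) i.2
      simp at this
    · intro j hj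
      by_contra hmem
      simp only [Finset.mem_insert, Finset.mem_singleton, not_or] at hmem
      exact hj (by simp [Equiv.swap_apply_of_ne_of_ne hmem.1 hmem.2])
  · by_cases hq : q ∈ b
    · refine (Finset.card_le_card (t := {⟨q, hq⟩, e.symm ⟨q, hq⟩}) fun i hi => ?_).trans
        Finset.card_le_two
      simp only [Finset.mem_filter, Finset.mem_univ, true_and, Finset.mem_insert,
        Finset.mem_singleton] at hi ⊢
      rcases hi with hi | hi
      · exact Or.inl (Subtype.ext hi.symm)
      · exact Or.inr (by rw [Equiv.eq_symm_apply]; exact Subtype.ext hi.symm)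
    · rw [Finset.filter_eq_empty_iff.mpr fun i _ hi => ?_]
      · simp
      · simp only [Finset.mem_insert, Finset.mem_singleton] at hi
        rcases hi with rfl | rfl
        · exact hq i.2
        · exact hq (e i).2

theorem Cx_le {n M : ℕ} {T : Set (Fin n → Fin M)} (hT : IsTypePromise T)
    {f : (Fin n → Fin M) → Bool} {A : RandAlg n M} (hA : BoundedError T f A)
    {x : Fin n → Fin M} (hx : x ∈ T) : Cx T f x ≤ 18 * suppDepth A ^ 2 := by
  obtain ⟨F, -, hF⟩ := Finite.exists_le_maximal
    (p := fun F : Finset (Finset (Fin n)) => (∀ b ∈ F, Minimal (SensBlock T f x) b) ∧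
      (F : Set (Finset (Fin n))).PairwiseDisjoint id) (a := ∅)
    ⟨by simp, by simp⟩
  obtain ⟨hmin, hdisj⟩ := hF.prop
  have hFcard : F.card ≤ 3 * suppDepth A := by
    have := card_le_of_sensBlocks (k := 1) hA hx F id (fun b hb => (hmin b hb).prop)
      (fun q => Finset.card_le_one.mpr fun b hb c hc => ?_)
    · simpa using this
    · rw [Finset.mem_filter] at hb hc
      by_contra hbc
      exact Finset.disjoint_left.mp (hdisj hb.1 hc.1 hbc) hb.2 hc.2
  set U := F.biUnion id
  set c : Fin n → Option (Fin M) := fun i => if i ∈ U then some (x i) else none with hc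
  have hagree : ∀ y, Consistent c y → ∀ i ∈ U, y i = x i :=
    fun y hy i hi => hy i (x i) (by simp [hc, hi])
  have hval : ∀ y ∈ T, Consistent c y → f y = f x := by
    intro y hy hcy
    by_contra hne
    have hsens : SensBlock T f x (Finset.univ.filter fun i => y i ≠ x i) :=
      ⟨y, hy, hne, fun i hi => by simpa using hi⟩
    obtain ⟨b, hbD, hb⟩ := Finite.exists_le_minimal hsens
    have hbU : ∀ i ∈ b, i ∉ U := fun i hi hiU =>
      (Finset.mem_filter.mp (hbD hi)).2 (hagree y hcy i hiU)
    have hb_mem : b ∈ F := by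
      refine hF.le_of_ge (y := insert b F) ⟨?_, ?_⟩ (Finset.subset_insert _ _)
        (Finset.mem_insert_self _ _)
      · intro d hd
        rcases Finset.mem_insert.mp hd with rfl | hd
        exacts [hb, hmin d hd]
      · rw [Finset.coe_insert]
        refine hdisj.insert fun d hd _ => Finset.disjoint_left.mpr fun i hi hid => ?_
        exact hbU i hi (Finset.mem_biUnion.mpr ⟨d, hd, hid⟩)
    obtain ⟨z, -, hzne, hz⟩ := hb.prop
    refine hzne (congrArg f (funext fun i => ?_))
    by_contra hi
    exact hbU i (hz i hi) (Finset.mem_biUnion.mpr ⟨b, hb_mem, hz i hi⟩)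
  have hsize : paSize c ≤ 18 * suppDepth A ^ 2 := by
    have hUc : paSize c = U.card := by simp [paSize, hc]
    rw [hUc]
    calc U.card ≤ F.card * (6 * suppDepth A) :=
          Finset.card_biUnion_le_card_mul _ _ _
            fun b hb => card_minimal_sensBlock_le hT hA hx (hmin b hb)
      _ ≤ 3 * suppDepth A * (6 * suppDepth A) := Nat.mul_le_mul_right _ hFcard
      _ = 18 * suppDepth A ^ 2 := by ring
  rw [Cx]
  refine le_trans (Nat.sInf_le ?_) hsize
  refine ⟨c, fun y hy z hz hcy hcz => ?_, fun i a hia => ?_, rfl⟩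
  · rw [hval y hy hcy, hval z hz hcz]
  · by_cases hi : i ∈ U
    · simpa [hc, hi] using hia
    · simp [hc, hi] at hia

/-- On a type promise, `C(f) ≤ 18 * R(f) ^ 2`. -/
theorem certC_le {n M : ℕ} {T : Set (Fin n → Fin M)} (hT : IsTypePromise T)
    (f : (Fin n → Fin M) → Bool) : certC T f ≤ 18 * randR T f ^ 2 := by
  obtain ⟨x₀, hx₀⟩ := id hT
  obtain ⟨A₀, hA₀⟩ := exists_boundedError x₀ T f
  obtain ⟨A, hA, hd⟩ := Nat.sInf_mem (s := {d | ∃ A : RandAlg n M, BoundedError T f A ∧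
    suppDepth A = d}) ⟨_, A₀, hA₀, rfl⟩
  rw [randR, ← hd]
  refine csSup_le ⟨_, x₀, by simp [hx₀], rfl⟩ ?_
  rintro _ ⟨x, hx, rfl⟩
  exact Cx_le hT hA hx

/-- on a type promise, `R(f) ≥ c · C(f)^{1/2}`. -/
theorem randR_ge_sqrt_certC : ∃ c : ℝ, 0 < c ∧
    ∀ (n M : ℕ), 1 ≤ n → 1 ≤ M →
    ∀ T : Set (Fin n → Fin M), IsTypePromise T →
    ∀ f : (Fin n → Fin M) → Bool,
      c * Real.sqrt (certC T f : ℝ) ≤ (randR T f : ℝ) := by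
  refine ⟨1 / 5, by norm_num, fun n M _ _ T hT f => ?_⟩
  have h : (certC T f : ℝ) ≤ (5 * (randR T f : ℝ)) ^ 2 := by
    have h18 : (certC T f : ℝ) ≤ 18 * (randR T f : ℝ) ^ 2 := by exact_mod_cast certC_le hT f
    nlinarith [sq_nonneg (randR T f : ℝ)]
  have hs := Real.sqrt_le_iff.mpr ⟨by positivity, h⟩
  linarith

end QCPaper
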